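/- arXiv:1801.03345 — 3 statements merged into one kernel-verified Lean document; each statement's English description precedes it below -/
import Mathlib

section
/- Set δ = exp(−(1 + Δ/2)²/2) / (2·√(2π)). Then for every ε with 0 < ε ≤ min(1/4, Δ), the μ-mass of the crown satisfies μ({x : δ·ε ≤ |η(x) − 1/2| ≤ ε}) ≥ δ·ε/Δ. -/
open MeasureTheory Real

/-- Standard Gaussian density on `ℝ^d`. -/
noncomputable def stdGaussianDensity (d : ℕ) (x : EuclideanSpace ℝ (Fin d)) : ℝ :=
  (2 * π) ^ (-(d : ℝ) / 2) * Real.exp (-‖x‖ ^ 2 / 2)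

/-- Regression function of the Gaussian translation model:
`η(x) = γ_d(x − m) / (γ_d(x) + γ_d(x − m))`. -/
noncomputable def gaussEta (d : ℕ) (m : EuclideanSpace ℝ (Fin d))
    (x : EuclideanSpace ℝ (Fin d)) : ℝ :=
  stdGaussianDensity d (x - m) / (stdGaussianDensity d x + stdGaussianDensity d (x - m))

/-- Marginal (mixture) law of the design: density `(γ_d(x) + γ_d(x − m))/2`
with respect to Lebesgue measure. -/
noncomputable def gaussMixture (d : ℕ) (m : EuclideanSpace ℝ (Fin d)) :
    Measure (EuclideanSpace ℝ (Fin d)) :=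
  volume.withDensity fun x =>
    ENNReal.ofReal ((stdGaussianDensity d x + stdGaussianDensity d (x - m)) / 2)

open ProbabilityTheory

lemma stdGaussianDensity_eq_prod {d : ℕ}
    (b : OrthonormalBasis (Fin d) ℝ (EuclideanSpace ℝ (Fin d))) (y : EuclideanSpace ℝ (Fin d)) :
    stdGaussianDensity d y = ∏ i, gaussianPDFReal 0 1 (b.repr y i) := by
  have h1 : ‖y‖ ^ 2 = ∑ i, (b.repr y i) ^ 2 := by
    rw [← b.repr.norm_map y, EuclideanSpace.real_norm_sq_eq]
  have h2 : (2 * π) ^ (-(d : ℝ) / 2) = ((√(2 * π))⁻¹) ^ d := by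
    rw [Real.sqrt_eq_rpow, ← Real.rpow_neg (by positivity), ← Real.rpow_natCast,
      ← Real.rpow_mul (by positivity)]
    congr 1
    ring
  simp only [stdGaussianDensity, gaussianPDFReal, Finset.prod_mul_distrib, ← Real.exp_sum, h1, h2]
  simp [neg_div, Finset.sum_div]

/-- The marginal of the standard Gaussian density along a unit direction is `N(0, 1)`. -/
lemma setLIntegral_stdGaussianDensity {d : ℕ}
    (b : OrthonormalBasis (Fin d) ℝ (EuclideanSpace ℝ (Fin d))) (i₀ : Fin d)
    {A : Set ℝ} (hA : MeasurableSet A) :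
    ∫⁻ y in {y | b.repr y i₀ ∈ A}, ENNReal.ofReal (stdGaussianDensity d y)
      = gaussianReal 0 1 A := by
  classical
  set f : Fin d → ℝ → ℝ := fun i => if i = i₀ then A.indicator (gaussianPDFReal 0 1)
    else gaussianPDFReal 0 1 with hf
  have hf_int : ∀ i, Integrable (f i) := by
    intro i
    by_cases h : i = i₀
    · simpa [hf, h] using (integrable_gaussianPDFReal 0 1).indicator hA
    · simpa [hf, h] using integrable_gaussianPDFReal 0 1
  have hf_nonneg : ∀ i t, 0 ≤ f i t := by
    intro i t
    by_cases h : i = i₀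
    · simpa [hf, h] using Set.indicator_nonneg (fun x _ => gaussianPDFReal_nonneg 0 1 x) t
    · simpa [hf, h] using gaussianPDFReal_nonneg 0 1 t
  have hS : MeasurableSet {y : EuclideanSpace ℝ (Fin d) | b.repr y i₀ ∈ A} := by
    have : Measurable fun y : EuclideanSpace ℝ (Fin d) => b.repr y i₀ := by fun_prop
    exact this hA
  have hpt : ∀ y, Set.indicator {y : EuclideanSpace ℝ (Fin d) | b.repr y i₀ ∈ A}
      (fun y => ENNReal.ofReal (stdGaussianDensity d y)) y
      = ENNReal.ofReal (∏ i, f i (b.repr y i)) := by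
    intro y
    by_cases h : b.repr y i₀ ∈ A
    · rw [Set.indicator_of_mem (by exact h), stdGaussianDensity_eq_prod b]
      congr 1
      refine Finset.prod_congr rfl fun i _ => ?_
      by_cases hi : i = i₀
      · subst hi
        simp [hf, Set.indicator_of_mem h]
      · simp [hf, hi]
    · rw [Set.indicator_of_notMem (by exact h), Finset.prod_eq_zero (Finset.mem_univ i₀)]
      · simp
      · simp [hf, Set.indicator_of_notMem h]
  have hmp : MeasurePreserving fun y : EuclideanSpace ℝ (Fin d) => WithLp.ofLp (b.repr y) :=
    (PiLp.volume_preserving_ofLp (Fin d)).comp b.measurePreserving_repr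
  have hf_meas : ∀ i, Measurable (f i) := by
    intro i
    by_cases h : i = i₀
    · simpa [hf, h] using (measurable_gaussianPDFReal 0 1).indicator hA
    · simpa [hf, h] using measurable_gaussianPDFReal 0 1
  rw [← lintegral_indicator hS, lintegral_congr hpt,
    hmp.lintegral_comp (f := fun x : Fin d → ℝ => ENNReal.ofReal (∏ i, f i (x i)))
      (by fun_prop),
    ← ofReal_integral_eq_lintegral_ofReal (μ := (volume : Measure (Fin d → ℝ)))
      (Integrable.fintype_prod hf_int)
      (ae_of_all _ fun x => Finset.prod_nonneg fun i _ => hf_nonneg i _),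
    integral_fintype_prod_volume_eq_prod, Finset.prod_eq_single i₀]
  · simp [hf, integral_indicator hA, gaussianReal_apply_eq_integral 0 one_ne_zero A]
  · intro i _ hi
    simp [hf, hi, integral_gaussianPDFReal_eq_one]
  · simp

lemma ofReal_le_gaussianReal_Icc {a c : ℝ} (ha : 0 ≤ a) (hc : c ≤ 1) :
    ENNReal.ofReal (Real.exp (-1 / 2) / √(2 * π) * (c - a)) ≤ gaussianReal 0 1 (Set.Icc a c) := by
  rw [gaussianReal_apply 0 one_ne_zero, ENNReal.ofReal_mul (by positivity), ← Real.volume_Icc,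
    ← setLIntegral_const]
  refine setLIntegral_mono (by fun_prop) fun x hx => ENNReal.ofReal_le_ofReal ?_
  have hx2 : x ^ 2 ≤ 1 := by nlinarith [hx.1, hx.2]
  rw [div_eq_inv_mul, gaussianPDFReal]
  simp only [NNReal.coe_one, mul_one, sub_zero]
  gcongr

lemma stdGaussianDensity_pos (d : ℕ) (x : EuclideanSpace ℝ (Fin d)) :
    0 < stdGaussianDensity d x := by
  unfold stdGaussianDensity
  positivity

/-- The mixture density dominates the geometric mean of its two components. -/
lemma stdGaussianDensity_midpoint_le (d : ℕ) (m x : EuclideanSpace ℝ (Fin d)) :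
    Real.exp (-‖m‖ ^ 2 / 8) * stdGaussianDensity d (x - (1 / 2 : ℝ) • m)
      ≤ (stdGaussianDensity d x + stdGaussianDensity d (x - m)) / 2 := by
  set p := Real.exp (-‖x‖ ^ 2 / 4) with hp
  set q := Real.exp (-‖x - m‖ ^ 2 / 4) with hq
  have h1 : stdGaussianDensity d x = (2 * π) ^ (-(d : ℝ) / 2) * (p * p) := by
    rw [stdGaussianDensity, hp, ← Real.exp_add]
    ring_nf
  have h2 : stdGaussianDensity d (x - m) = (2 * π) ^ (-(d : ℝ) / 2) * (q * q) := by
    rw [stdGaussianDensity, hq, ← Real.exp_add]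
    ring_nf
  have h3 : Real.exp (-‖m‖ ^ 2 / 8) * stdGaussianDensity d (x - (1 / 2 : ℝ) • m)
      = (2 * π) ^ (-(d : ℝ) / 2) * (p * q) := by
    rw [stdGaussianDensity, hp, hq, mul_left_comm, ← Real.exp_add, ← Real.exp_add]
    congr 2
    rw [norm_sub_sq_real, norm_sub_sq_real, inner_smul_right, norm_smul]
    norm_num
    ring
  rw [h1, h2, h3]
  have h4 : (0 : ℝ) ≤ (2 * π) ^ (-(d : ℝ) / 2) := by positivity
  nlinarith [mul_nonneg h4 (sq_nonneg (p - q))]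

lemma gaussEta_sub_half (d : ℕ) (m x : EuclideanSpace ℝ (Fin d)) :
    gaussEta d m x - 1 / 2 =
      (Real.exp (inner ℝ m (x - (1 / 2 : ℝ) • m)) - 1) /
        (2 * (Real.exp (inner ℝ m (x - (1 / 2 : ℝ) • m)) + 1)) := by
  have h : stdGaussianDensity d (x - m) =
      stdGaussianDensity d x * Real.exp (inner ℝ m (x - (1 / 2 : ℝ) • m)) := by
    rw [stdGaussianDensity, stdGaussianDensity, mul_assoc, ← Real.exp_add, norm_sub_sq_real,
      inner_sub_right, inner_smul_right, real_inner_self_eq_norm_sq, real_inner_comm]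
    congr 2
    ring
  have hpos := stdGaussianDensity_pos d x
  rw [gaussEta, h]
  field_simp
  ring

/-- On `ε / 2 ≤ t ≤ ε` the centered logistic function is comparable to `ε`. -/
lemma logistic_sub_half_bounds {ε t : ℝ} (hε0 : 0 < ε) (hε : ε ≤ 1 / 4) (h1 : ε / 2 ≤ t)
    (h2 : t ≤ ε) :
    31 / 250 * ε ≤ (Real.exp t - 1) / (2 * (Real.exp t + 1)) ∧
      (Real.exp t - 1) / (2 * (Real.exp t + 1)) ≤ ε := by
  have hlow : 1 + ε / 2 + (ε / 2) ^ 2 / 2 ≤ Real.exp t :=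
    (Real.quadratic_le_exp_of_nonneg (by positivity)).trans (Real.exp_le_exp.2 h1)
  have hpos := Real.exp_pos t
  constructor
  · rw [le_div_iff₀ (by positivity)]
    nlinarith
  · rw [div_le_iff₀ (by positivity)]
    have h3 : 1 - t ≤ Real.exp (-t) := by linarith [Real.add_one_le_exp (-t)]
    have h4 : Real.exp (-t) * Real.exp t = 1 := by rw [← Real.exp_add]; simp
    nlinarith

lemma crown_constant_le {Δ : ℝ} (hΔ : 0 ≤ Δ) :
    Real.exp (-(1 + Δ / 2) ^ 2 / 2) / (2 * √(2 * π)) ≤ 31 / 250 := by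
  have h1 : Real.exp (-(1 + Δ / 2) ^ 2 / 2) ≤ Real.exp (-(1 / 2)) :=
    Real.exp_le_exp.2 (by nlinarith)
  have h2 : (13 / 8 : ℝ) ≤ Real.exp (1 / 2) := by
    have := Real.quadratic_le_exp_of_nonneg (x := 1 / 2) (by norm_num)
    linarith
  have h3 : Real.exp (-(1 / 2)) ≤ 8 / 13 := by
    rw [Real.exp_neg, inv_le_comm₀ (Real.exp_pos _) (by norm_num)]
    linarith
  have h4 : (5 / 2 : ℝ) ≤ √(2 * π) := Real.le_sqrt_of_sq_le (by linarith [Real.pi_gt_d2])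
  rw [div_le_iff₀ (by positivity)]
  linarith

/-- Crown estimate (Proposition C.2, finite-dimensional form): with
`δ = exp(−(1+Δ/2)²/2)/(2√(2π))`, for `0 < ε ≤ min(1/4, Δ)`,
`μ(δε ≤ |η − 1/2| ≤ ε) ≥ δε/Δ`. -/
theorem crown_lower_bound (d : ℕ) (hd : 1 ≤ d)
    (m : EuclideanSpace ℝ (Fin d)) (hm : m ≠ 0)
    (δ : ℝ) (hδ : δ = Real.exp (-(1 + ‖m‖ / 2) ^ 2 / 2) / (2 * Real.sqrt (2 * π)))
    (ε : ℝ) (hε0 : 0 < ε) (hε : ε ≤ min (1 / 4) ‖m‖) :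
    ENNReal.ofReal (δ * ε / ‖m‖)
      ≤ gaussMixture d m
          {x | δ * ε ≤ |gaussEta d m x - 1 / 2| ∧ |gaussEta d m x - 1 / 2| ≤ ε} := by
  have hε4 : ε ≤ 1 / 4 := hε.trans (min_le_left _ _)
  have hεm : ε ≤ ‖m‖ := hε.trans (min_le_right _ _)
  have hΔ : 0 < ‖m‖ := norm_pos_iff.2 hm
  let i₀ : Fin d := ⟨0, hd⟩
  obtain ⟨b, hb⟩ : ∃ b : OrthonormalBasis (Fin d) ℝ (EuclideanSpace ℝ (Fin d)),
      b i₀ = ‖m‖⁻¹ • m := by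
    obtain ⟨b, hb⟩ := Orthonormal.exists_orthonormalBasis_extension_of_card_eq (𝕜 := ℝ)
      (E := EuclideanSpace ℝ (Fin d)) (ι := Fin d) (by simp) (v := fun _ => ‖m‖⁻¹ • m)
      (s := {i₀}) (by
        refine ⟨fun i => ?_, fun i j hij => absurd (Subsingleton.elim i j) hij⟩
        simp [norm_smul, hΔ.ne'])
    exact ⟨b, hb i₀ rfl⟩
  have hinner : ∀ y, inner ℝ m y = ‖m‖ * b.repr y i₀ := by
    intro y
    rw [b.repr_apply_apply, hb, real_inner_smul_left, mul_inv_cancel_left₀ hΔ.ne']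
  set T : Set (EuclideanSpace ℝ (Fin d)) :=
    {y | b.repr y i₀ ∈ Set.Icc (ε / (2 * ‖m‖)) (ε / ‖m‖)} with hT
  have hTm : MeasurableSet T := by
    have : Measurable fun y : EuclideanSpace ℝ (Fin d) => b.repr y i₀ := by fun_prop
    exact this measurableSet_Icc
  have hshift : Measurable fun x : EuclideanSpace ℝ (Fin d) => x - (1 / 2 : ℝ) • m := by fun_prop
  have hsub : (fun x => x - (1 / 2 : ℝ) • m) ⁻¹' T ⊆
      {x | δ * ε ≤ |gaussEta d m x - 1 / 2| ∧ |gaussEta d m x - 1 / 2| ≤ ε} := by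
    intro x hx
    obtain ⟨hx1, hx2⟩ : ε / (2 * ‖m‖) ≤ b.repr (x - (1 / 2 : ℝ) • m) i₀ ∧
      b.repr (x - (1 / 2 : ℝ) • m) i₀ ≤ ε / ‖m‖ := hx
    rw [div_le_iff₀ (by positivity)] at hx1
    rw [le_div_iff₀ hΔ] at hx2
    obtain ⟨h1, h2⟩ := logistic_sub_half_bounds (t := inner ℝ m (x - (1 / 2 : ℝ) • m)) hε0 hε4
      (by rw [hinner]; linarith) (by rw [hinner]; linarith)
    rw [← gaussEta_sub_half] at h1 h2
    rw [Set.mem_ofPred_eq, abs_of_nonneg (le_trans (by positivity) h1)]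
    refine ⟨le_trans ?_ h1, h2⟩
    rw [hδ]
    exact mul_le_mul_of_nonneg_right (crown_constant_le hΔ.le) hε0.le
  have hconst : δ * ε / ‖m‖ ≤ Real.exp (-‖m‖ ^ 2 / 8) *
      (Real.exp (-1 / 2) / √(2 * π) * (ε / ‖m‖ - ε / (2 * ‖m‖))) := by
    have h1 : Real.exp (-(1 + ‖m‖ / 2) ^ 2 / 2) ≤
        Real.exp (-‖m‖ ^ 2 / 8) * Real.exp (-1 / 2) := by
      rw [← Real.exp_add]
      exact Real.exp_le_exp.2 (by nlinarith)
    calc δ * ε / ‖m‖ = Real.exp (-(1 + ‖m‖ / 2) ^ 2 / 2) * (ε / (2 * √(2 * π) * ‖m‖)) := by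
          rw [hδ]; field_simp
      _ ≤ Real.exp (-‖m‖ ^ 2 / 8) * Real.exp (-1 / 2) * (ε / (2 * √(2 * π) * ‖m‖)) := by gcongr
      _ = _ := by field_simp; ring
  have hmeas : Measurable (stdGaussianDensity d) := by
    unfold stdGaussianDensity
    fun_prop
  calc ENNReal.ofReal (δ * ε / ‖m‖)
      ≤ ENNReal.ofReal (Real.exp (-‖m‖ ^ 2 / 8)) *
          ENNReal.ofReal (Real.exp (-1 / 2) / √(2 * π) * (ε / ‖m‖ - ε / (2 * ‖m‖))) := by
        rw [← ENNReal.ofReal_mul (by positivity)]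
        exact ENNReal.ofReal_le_ofReal hconst
    _ ≤ ENNReal.ofReal (Real.exp (-‖m‖ ^ 2 / 8)) *
          gaussianReal 0 1 (Set.Icc (ε / (2 * ‖m‖)) (ε / ‖m‖)) := by
        gcongr
        exact ofReal_le_gaussianReal_Icc (by positivity) ((div_le_one hΔ).2 hεm)
    _ = ∫⁻ y in T, ENNReal.ofReal (Real.exp (-‖m‖ ^ 2 / 8) * stdGaussianDensity d y) := by
        simp_rw [ENNReal.ofReal_mul (Real.exp_pos _).le]
        rw [lintegral_const_mul _ (by fun_prop),
          setLIntegral_stdGaussianDensity b i₀ measurableSet_Icc]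
    _ = ∫⁻ x in (fun x => x - (1 / 2 : ℝ) • m) ⁻¹' T,
          ENNReal.ofReal (Real.exp (-‖m‖ ^ 2 / 8) *
            stdGaussianDensity d (x - (1 / 2 : ℝ) • m)) :=
        ((measurePreserving_sub_right volume ((1 / 2 : ℝ) • m)).setLIntegral_comp_preimage hTm
          (f := fun y => ENNReal.ofReal (Real.exp (-‖m‖ ^ 2 / 8) * stdGaussianDensity d y))
          (by fun_prop)).symm
    _ ≤ ∫⁻ x in (fun x => x - (1 / 2 : ℝ) • m) ⁻¹' T,
          ENNReal.ofReal ((stdGaussianDensity d x + stdGaussianDensity d (x - m)) / 2) :=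
        lintegral_mono fun x => ENNReal.ofReal_le_ofReal (stdGaussianDensity_midpoint_le d m x)
    _ = gaussMixture d m ((fun x => x - (1 / 2 : ℝ) • m) ⁻¹' T) :=
        (withDensity_apply _ (hshift hTm)).symm
    _ ≤ _ := measure_mono hsub
end

section
/- Let z ∈ ℝ², let u, v ∈ ℝ² be linearly independent, and let C = { z + a·u + b·v : (a > 0 and b > 0) or (a < 0 and b < 0) } be the open double cone with apex z generated by u and v. Let A = arccos(⟨u,v⟩/(‖u‖·‖v‖)) ∈ (0, π) be the angle of the cone. Then the standard Gaussian measure of C satisfies (1/(2π)) · ∫_C exp(−‖x‖²/2) dx ≥ (A/(2π)) · exp(−‖z‖²), where the integral is with respect to Lebesgue measure on EuclideanSpace ℝ (Fin 2). -/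
open MeasureTheory InnerProductGeometry Real

/-- A planar sector with apex `0` has mass proportional to its set of directions under the density
`exp (-‖w‖ ^ 2)`. -/
theorem integral_exp_neg_sq_norm_arg_mem {T : Set ℝ} (hT : MeasurableSet T)
    (hTπ : T ⊆ Set.Ioo (-π) π) :
    ∫ w in {w : ℂ | w.arg ∈ T}, rexp (-‖w‖ ^ 2) = volume.real T / 2 := by
  have hS : MeasurableSet {w : ℂ | w.arg ∈ T} := Complex.measurable_arg hT
  rw [← integral_indicator hS, ← Complex.integral_comp_polarCoord_symm]
  have hcongr : ∀ p ∈ polarCoord.target,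
      p.1 • ({w : ℂ | w.arg ∈ T}.indicator (fun w => rexp (-‖w‖ ^ 2)))
        (Complex.polarCoord.symm p)
      = (p.1 * rexp (-p.1 ^ 2)) * T.indicator (fun _ => (1 : ℝ)) p.2 := by
    rintro ⟨r, θ⟩ ⟨hr, hθ⟩
    have harg : (Complex.polarCoord.symm (r, θ)).arg = θ := by
      rw [Complex.polarCoord_symm_apply]
      simpa using Complex.arg_mul_cos_add_sin_mul_I hr (Set.Ioo_subset_Ioc_self hθ)
    by_cases h : θ ∈ T <;>
      simp [-Complex.polarCoord_symm_apply, Complex.norm_polarCoord_symm, Set.indicator, harg, h]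
  have hmeas : MeasurableSet polarCoord.target := polarCoord.open_target.measurableSet
  rw [setIntegral_congr_fun hmeas hcongr, polarCoord_target, Measure.volume_eq_prod,
    setIntegral_prod_mul (fun r : ℝ => r * rexp (-r ^ 2)) (T.indicator fun _ => (1 : ℝ))]
  have hradial : ∫ r in Set.Ioi (0 : ℝ), r * rexp (-r ^ 2) = 1 / 2 := by
    have h := integral_rpow_mul_exp_neg_rpow (p := 2) (q := 1) (by norm_num) (by norm_num)
    norm_num at h
    simpa using h
  rw [hradial, setIntegral_indicator hT, Set.inter_eq_right.mpr hTπ]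
  simp
  ring

/-- Two nonzero vectors of a Euclidean plane can be moved by an isometry onto the positive real
axis and into the closed upper half plane of `ℂ`, respectively. -/
theorem exists_linearIsometryEquiv_complex_angle {u v : EuclideanSpace ℝ (Fin 2)} (hu : u ≠ 0)
    (hv : v ≠ 0) :
    ∃ ψ : EuclideanSpace ℝ (Fin 2) ≃ₗᵢ[ℝ] ℂ,
      ψ u = ‖u‖ ∧ ψ v = ‖v‖ * Complex.exp (angle u v * Complex.I) := by
  let ψ₀ : EuclideanSpace ℝ (Fin 2) ≃ₗᵢ[ℝ] ℂ := Complex.orthonormalBasisOneI.repr.symm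
  have hp : ψ₀ u ≠ 0 := by simpa using hu
  have hq : ψ₀ v ≠ 0 := by simpa using hv
  have hangle : angle u v = |(ψ₀ v / ψ₀ u).arg| := by
    rw [← Complex.angle_eq_abs_arg hq hp, angle_comm,
      ← LinearIsometry.angle_map ψ₀.toLinearIsometry]
    rfl
  have hnp : ‖ψ₀ u‖ = ‖u‖ := ψ₀.norm_map u
  have hnq : ‖ψ₀ v‖ = ‖v‖ := ψ₀.norm_map v
  have hu' : (‖u‖ : ℂ) ≠ 0 := by simpa using hu
  let c : Circle := ⟨‖u‖ / ψ₀ u, by simp [Submonoid.unitSphere, hnp, hu]⟩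
  have hcu : rotation c (ψ₀ u) = ‖u‖ := by
    rw [rotation_apply]; exact div_mul_cancel₀ _ hp
  have hcv : rotation c (ψ₀ v) = ‖v‖ * Complex.exp ((ψ₀ v / ψ₀ u).arg * Complex.I) := by
    have h := Complex.norm_mul_exp_arg_mul_I (ψ₀ v / ψ₀ u)
    rw [norm_div, hnp, hnq] at h
    rw [rotation_apply]
    change ‖u‖ / ψ₀ u * ψ₀ v = _
    rw [div_mul_eq_mul_div, mul_div_assoc]
    generalize (ψ₀ v / ψ₀ u).arg = θ at h ⊢
    rw [← h]
    push_cast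
    field_simp
  rcases le_total 0 (ψ₀ v / ψ₀ u).arg with h | h
  · refine ⟨ψ₀.trans (rotation c), hcu, ?_⟩
    rw [hangle, abs_of_nonneg h]
    exact hcv
  · refine ⟨(ψ₀.trans (rotation c)).trans Complex.conjLIE, ?_, ?_⟩
    · simp [hcu]
    · rw [hangle, abs_of_nonpos h]
      simp [hcv, ← Complex.exp_conj]

theorem sin_angle_pos_of_linearIndependent {V : Type*} [NormedAddCommGroup V]
    [InnerProductSpace ℝ V] {u v : V} (huv : LinearIndependent ℝ ![u, v]) :
    0 < sin (angle u v) := by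
  have hne : ∀ r : ℝ, v ≠ r • u := by
    intro r h
    have h' := LinearIndependent.pair_iff.mp huv r (-1) (by rw [h]; module)
    norm_num at h'
  refine (sin_angle_nonneg u v).lt_of_ne' fun h => ?_
  rcases sin_eq_zero_iff_angle_eq_zero_or_angle_eq_pi.mp h with h | h
  · obtain ⟨-, r, -, hr⟩ := angle_eq_zero_iff.mp h
    exact hne r hr
  · obtain ⟨-, r, -, hr⟩ := angle_eq_pi_iff.mp h
    exact hne r hr

/-- The coordinates of a complex number in the basis `s`, `t * exp (α * I)`. -/
theorem complex_eq_sin_smul_add_sin_smul {s t α : ℝ} (hs : s ≠ 0) (ht : t ≠ 0) (hα : sin α ≠ 0)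
    (w : ℂ) :
    w = (‖w‖ * sin (α - w.arg) / (s * sin α)) • (s : ℂ)
      + (‖w‖ * sin w.arg / (t * sin α)) • (t * Complex.exp (α * Complex.I)) := by
  have hre : w.re = ‖w‖ * cos w.arg := (Complex.norm_mul_cos_arg w).symm
  have him : w.im = ‖w‖ * sin w.arg := (Complex.norm_mul_sin_arg w).symm
  apply Complex.ext
  · simp only [Complex.add_re, Complex.smul_re, smul_eq_mul, Complex.ofReal_re,
      Complex.re_ofReal_mul, Complex.exp_ofReal_mul_I_re]
    rw [sin_sub, hre]
    field_simp
    ring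
  · simp only [Complex.add_im, Complex.smul_im, smul_eq_mul, Complex.ofReal_im,
      Complex.im_ofReal_mul, Complex.exp_ofReal_mul_I_im]
    rw [him]
    field_simp
    ring

theorem integrable_exp_neg_mul_sq_norm {V : Type*} [NormedAddCommGroup V] [InnerProductSpace ℝ V]
    [FiniteDimensional ℝ V] [MeasurableSpace V] [BorelSpace V] {b : ℝ} (hb : 0 < b) :
    Integrable fun x : V => rexp (-b * ‖x‖ ^ 2) := by
  refine Integrable.of_integral_ne_zero ?_
  rw [GaussianFourier.integral_rexp_neg_mul_sq_norm hb]
  positivity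

/-- Lemma B.4: the standard Gaussian measure of an open double cone with apex `z`
and angle `A` is at least `(A/(2π))·e^{−‖z‖²}`. -/
theorem gaussian_mass_double_cone (z u v : EuclideanSpace ℝ (Fin 2))
    (huv : LinearIndependent ℝ ![u, v])
    (C : Set (EuclideanSpace ℝ (Fin 2)))
    (hC : C = {x | ∃ a b : ℝ, ((0 < a ∧ 0 < b) ∨ (a < 0 ∧ b < 0)) ∧ x = z + a • u + b • v}) :
    (angle u v / (2 * π)) * Real.exp (-‖z‖ ^ 2)
      ≤ (1 / (2 * π)) * ∫ x in C, Real.exp (-‖x‖ ^ 2 / 2) := by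
  have hu : u ≠ 0 := huv.ne_zero 0
  have hv : v ≠ 0 := huv.ne_zero 1
  have hsin := sin_angle_pos_of_linearIndependent huv
  obtain ⟨ψ, hψu, hψv⟩ := exists_linearIsometryEquiv_complex_angle hu hv
  have hA0 : 0 ≤ angle u v := angle_nonneg u v
  have hAπ : angle u v ≤ π := angle_le_pi u v
  set A := angle u v
  let T : Set ℝ := Set.Ioo 0 A ∪ Set.Ioo (-π) (A - π)
  have hT : MeasurableSet T := measurableSet_Ioo.union measurableSet_Ioo
  have hTπ : T ⊆ Set.Ioo (-π) π := by
    rintro θ (⟨h1, h2⟩ | ⟨h1, h2⟩) <;> constructor <;> linarith [pi_pos]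
  have hTvol : volume.real T = 2 * A := by
    rw [measureReal_union _ measurableSet_Ioo (by simp) (by simp)]
    · simp [hA0]
      ring
    · rw [Set.disjoint_left]
      rintro θ ⟨h1, -⟩ ⟨-, h2⟩
      linarith
  let S : Set (EuclideanSpace ℝ (Fin 2)) := {x | (ψ (x - z)).arg ∈ T}
  have hS : MeasurableSet S :=
    (Complex.measurable_arg.comp (ψ.continuous.measurable.comp (measurable_id.sub_const z))) hT
  have hSC : S ⊆ C := by
    intro x hx
    have hu' : 0 < ‖u‖ := norm_pos_iff.mpr hu
    have hv' : 0 < ‖v‖ := norm_pos_iff.mpr hv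
    have hw := complex_eq_sin_smul_add_sin_smul hu'.ne' hv'.ne' hsin.ne' (ψ (x - z))
    rw [← hψu, ← hψv, ← map_smul, ← map_smul, ← map_add] at hw
    have hnorm : 0 < ‖ψ (x - z)‖ := by
      refine norm_pos_iff.mpr fun h => ?_
      rcases hx with ⟨h1, h2⟩ | ⟨h1, h2⟩ <;> rw [h, Complex.arg_zero] at h1 h2 <;> linarith
    rw [hC]
    refine ⟨_, _, ?_, by rw [add_assoc, ← ψ.injective hw]; abel⟩
    rcases hx with ⟨h1, h2⟩ | ⟨h1, h2⟩
    · left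
      have := sin_pos_of_pos_of_lt_pi h1 (h2.trans_le hAπ)
      have := sin_pos_of_pos_of_lt_pi (x := A - (ψ (x - z)).arg) (by linarith) (by linarith)
      constructor <;> positivity
    · right
      have h3 := sin_neg_of_neg_of_neg_pi_lt (x := (ψ (x - z)).arg) (by linarith) h1
      have h4 : sin (A - (ψ (x - z)).arg) < 0 := by
        rw [← neg_pos, ← sin_sub_pi]
        exact sin_pos_of_pos_of_lt_pi (by linarith) (by linarith)
      exact ⟨div_neg_of_neg_of_pos (mul_neg_of_pos_of_neg hnorm h4) (by positivity),
        div_neg_of_neg_of_pos (mul_neg_of_pos_of_neg hnorm h3) (by positivity)⟩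
  have hint : Integrable fun x : EuclideanSpace ℝ (Fin 2) => rexp (-‖x‖ ^ 2 / 2) := by
    convert integrable_exp_neg_mul_sq_norm (V := EuclideanSpace ℝ (Fin 2)) (b := 1 / 2)
      (by norm_num) using 3
    ring
  have hint' : Integrable fun x : EuclideanSpace ℝ (Fin 2) =>
      rexp (-‖z‖ ^ 2) * rexp (-‖x - z‖ ^ 2) := by
    have h := (integrable_exp_neg_mul_sq_norm (V := EuclideanSpace ℝ (Fin 2)) one_pos)
    simp only [neg_mul, one_mul] at h
    exact (h.comp_sub_right z).const_mul _
  have hsector : ∫ x in S, rexp (-‖x - z‖ ^ 2) = A := by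
    have h1 := (measurePreserving_sub_right volume z).setIntegral_preimage_emb
      (measurableEmbedding_subRight z) (fun y => rexp (-‖y‖ ^ 2)) {y | (ψ y).arg ∈ T}
    have h2 := ψ.measurePreserving.setIntegral_preimage_emb
      ψ.toMeasurableEquiv.measurableEmbedding (fun w => rexp (-‖w‖ ^ 2)) {w | w.arg ∈ T}
    simp only [ψ.norm_map] at h2
    refine h1.trans (h2.trans ?_)
    rw [integral_exp_neg_sq_norm_arg_mem hT hTπ, hTvol]
    ring
  have hmain : A * rexp (-‖z‖ ^ 2) ≤ ∫ x in C, rexp (-‖x‖ ^ 2 / 2) := by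
    calc A * rexp (-‖z‖ ^ 2) = ∫ x in S, rexp (-‖z‖ ^ 2) * rexp (-‖x - z‖ ^ 2) := by
          rw [integral_const_mul, hsector, mul_comm]
      _ ≤ ∫ x in S, rexp (-‖x‖ ^ 2 / 2) := by
          refine setIntegral_mono hint'.integrableOn hint.integrableOn fun x => ?_
          rw [← exp_add, exp_le_exp]
          have h : ‖x‖ ≤ ‖z‖ + ‖x - z‖ := by simpa using norm_add_le z (x - z)
          nlinarith [sq_nonneg (‖z‖ - ‖x - z‖), norm_nonneg x]
      _ ≤ ∫ x in C, rexp (-‖x‖ ^ 2 / 2) :=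
          setIntegral_mono_set hint.integrableOn (.of_forall fun _ => (exp_pos _).le)
            hSC.eventuallyLE
  calc A / (2 * π) * rexp (-‖z‖ ^ 2) = 1 / (2 * π) * (A * rexp (-‖z‖ ^ 2)) := by ring
    _ ≤ _ := by gcongr
end

section
/- Let d ≥ 7 be an integer, ε > 0, and Δ ≥ √d · ε. Let G be the standard Gaussian measure on ℝ^d (the d-fold product of real standard Gaussians, equivalently the measure with density x ↦ (2π)^(−d/2)·exp(−‖x‖²/2) with respect to Lebesgue measure on EuclideanSpace ℝ (Fin d)). Then there exists a finite set Θ ⊆ ℝ^d whose elements θ satisfy θ_1 = Δ and θ_j ∈ {−ε, ε} for 2 ≤ j ≤ d, with cardinality |Θ| ≥ exp((d−1)/8) ≥ 2, and such that for all θ ≠ θ' in Θ the symmetric difference of the two half-spaces has Gaussian mass G( {x : ‖x − θ‖ ≤ ‖x‖} Δ {x : ‖x − θ'‖ ≤ ‖x‖} ) ≥ (√(d−1)·ε/(4·π·Δ)) · exp(−Δ²). -/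
open MeasureTheory Real

/-- A Gilbert–Varshamov bound for binary codes of minimum relative distance `1 / 8`. -/
theorem exists_code_hammingDist (m : ℕ) :
    ∃ C : Finset (Fin m → Bool), Real.exp ((m : ℝ) / 8) ≤ C.card ∧
      ∀ x ∈ C, ∀ y ∈ C, x ≠ y → (m : ℝ) / 8 ≤ hammingDist x y := by
  classical
  let P : Finset (Fin m → Bool) → Prop := fun C =>
    ∀ x ∈ C, ∀ y ∈ C, x ≠ y → (m : ℝ) / 8 ≤ hammingDist x y
  obtain ⟨C, hC⟩ := (Set.toFinite {C | P C}).exists_maximal ⟨∅, by simp [P]⟩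
  refine ⟨C, ?_, hC.1⟩
  have cover (y : Fin m → Bool) : ∃ x ∈ C, (hammingDist x y : ℝ) ≤ m / 8 := by
    by_contra! h
    have hy : y ∈ C := by
      refine hC.2 (y := insert y C) ?_ (Finset.subset_insert y C) (Finset.mem_insert_self y C)
      intro a ha b hb hab
      rcases Finset.mem_insert.1 ha with rfl | ha' <;> rcases Finset.mem_insert.1 hb with rfl | hb'
      · exact absurd rfl hab
      · rw [hammingDist_comm]; exact (h b hb').le
      · exact (h a ha').le
      · exact hC.1 a ha' b hb' hab
    have := h y hy
    rw [hammingDist_self, Nat.cast_zero] at this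
    have : (0 : ℝ) ≤ m / 8 := by positivity
    linarith
  have weight (x : Fin m → Bool) : ∑ y, (1 / 2 : ℝ) ^ hammingDist x y = (3 / 2) ^ m := by
    have h := Finset.prod_univ_sum (fun _ : Fin m => (Finset.univ : Finset Bool))
      (fun i b => if x i ≠ b then (1 / 2 : ℝ) else 1)
    have h1 (i : Fin m) : ∑ b, (if x i ≠ b then (1 / 2 : ℝ) else 1) = 3 / 2 := by
      cases x i <;> norm_num
    simp only [h1, Finset.prod_const, Finset.card_univ, Fintype.card_fin, Fintype.piFinset_univ] at h
    rw [h]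
    refine Finset.sum_congr rfl fun y _ => ?_
    rw [Finset.prod_ite, Finset.prod_const, Finset.prod_const_one, mul_one, hammingDist]
  have count : (2 : ℝ) ^ m ≤ C.card * ((2 : ℝ) ^ ((m : ℝ) / 8) * (3 / 2) ^ m) := by
    have h (y : Fin m → Bool) :
        1 ≤ ∑ x ∈ C, (2 : ℝ) ^ ((m : ℝ) / 8) * (1 / 2) ^ hammingDist x y := by
      obtain ⟨x, hx, hxy⟩ := cover y
      refine le_trans ?_ (Finset.single_le_sum (f := fun x =>
        (2 : ℝ) ^ ((m : ℝ) / 8) * (1 / 2) ^ hammingDist x y) (fun _ _ => by positivity) hx)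
      have := Real.rpow_le_rpow_of_exponent_le (one_le_two (α := ℝ)) hxy
      rw [Real.rpow_natCast] at this
      rw [one_div, inv_pow, ← div_eq_mul_inv, one_le_div (by positivity)]
      exact this
    calc (2 : ℝ) ^ m = ∑ _y : Fin m → Bool, (1 : ℝ) := by simp
      _ ≤ ∑ y, ∑ x ∈ C, (2 : ℝ) ^ ((m : ℝ) / 8) * (1 / 2) ^ hammingDist x y :=
        Finset.sum_le_sum fun y _ => h y
      _ = _ := by
        rw [Finset.sum_comm]
        simp_rw [← Finset.mul_sum, weight, Finset.sum_const, nsmul_eq_mul]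
        ring
  have hlog : Real.exp ((m : ℝ) / 8) * ((2 : ℝ) ^ ((m : ℝ) / 8) * (3 / 2) ^ m) ≤ 2 ^ m := by
    have e43 : (1 : ℝ) / 4 ≤ Real.log (4 / 3) := by
      have := Real.one_sub_inv_le_log_of_pos (x := 4 / 3) (by norm_num)
      norm_num at this ⊢; linarith
    have key : Real.exp ((m : ℝ) / 8) * (2 : ℝ) ^ ((m : ℝ) / 8) ≤ (4 / 3) ^ m := by
      rw [← Real.rpow_natCast (4 / 3), Real.rpow_def_of_pos two_pos,
        Real.rpow_def_of_pos (by norm_num), ← Real.exp_add]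
      apply Real.exp_le_exp.2
      have hm : (0 : ℝ) ≤ m := m.cast_nonneg
      nlinarith [Real.log_two_lt_d9]
    calc _ = Real.exp ((m : ℝ) / 8) * (2 : ℝ) ^ ((m : ℝ) / 8) * (3 / 2) ^ m := by ring
      _ ≤ (4 / 3) ^ m * (3 / 2) ^ m := by gcongr
      _ = 2 ^ m := by rw [← mul_pow]; norm_num
  exact le_of_mul_le_mul_right (hlog.trans count) (by positivity)

/-- The standard Gaussian measure has the standard Gaussian density. -/
theorem withDensity_eq_stdGaussian (E : Type*) [NormedAddCommGroup E] [InnerProductSpace ℝ E]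
    [FiniteDimensional ℝ E] [MeasurableSpace E] [BorelSpace E] :
    (volume : Measure E).withDensity (fun x => ENNReal.ofReal
      ((2 * π) ^ (-(Module.finrank ℝ E : ℝ) / 2) * Real.exp (-‖x‖ ^ 2 / 2))) =
      ProbabilityTheory.stdGaussian E := by
  set K : ℝ := (2 * π) ^ (-(Module.finrank ℝ E : ℝ) / 2) with hK
  have hK0 : 0 < K := by positivity
  have hint : Integrable (fun x : E => K * Real.exp (-‖x‖ ^ 2 / 2)) := by
    have h := (GaussianFourier.integrable_cexp_neg_mul_sq_norm_add (V := E) (b := 1 / 2)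
      (by norm_num) 0 0).norm.const_mul K
    refine h.congr (ae_of_all _ fun x => ?_)
    simp only [Complex.norm_exp, zero_mul, add_zero]
    congr 2
    rw [← Complex.ofReal_pow, mul_comm, Complex.re_ofReal_mul]
    norm_num
    ring
  have := isFiniteMeasure_withDensity_ofReal hint.2
  refine Measure.ext_of_charFun ?_
  ext t
  rw [ProbabilityTheory.charFun_stdGaussian, charFun_apply,
    integral_withDensity_eq_integral_toReal_smul (by fun_prop) (by simp)]
  have hcongr (x : E) : (ENNReal.ofReal (K * Real.exp (-‖x‖ ^ 2 / 2))).toReal •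
      Complex.exp (inner ℝ x t * Complex.I) =
      K * Complex.exp (-(1 / 2) * ‖x‖ ^ 2 + Complex.I * inner ℝ t x) := by
    rw [ENNReal.toReal_ofReal (by positivity), Complex.real_smul, real_inner_comm]
    push_cast
    rw [mul_assoc, ← Complex.exp_add]
    congr 2
    ring
  simp_rw [hcongr]
  rw [integral_const_mul, GaussianFourier.integral_cexp_neg_mul_sq_norm_add (by norm_num)]
  have hpow : (K : ℂ) * (π / (1 / 2)) ^ (Module.finrank ℝ E / 2 : ℂ) = 1 := by
    rw [show (π / (1 / 2) : ℂ) = ((2 * π : ℝ) : ℂ) by push_cast; ring,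
      show (Module.finrank ℝ E / 2 : ℂ) = ((Module.finrank ℝ E / 2 : ℝ) : ℂ) by push_cast; rfl,
      ← Complex.ofReal_cpow (by positivity), ← Complex.ofReal_mul, hK,
      ← Real.rpow_add (by positivity), neg_div, neg_add_cancel, Real.rpow_zero, Complex.ofReal_one]
  rw [← mul_assoc, hpow, one_mul, Complex.I_sq]
  congr 1
  ring

/-- The coordinates along an orthonormal pair are jointly standard Gaussian. -/
theorem stdGaussian_map_orthonormal_pair {E : Type*} [NormedAddCommGroup E]
    [InnerProductSpace ℝ E] [FiniteDimensional ℝ E] [MeasurableSpace E] [BorelSpace E]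
    {u v : E} (hu : ‖u‖ = 1) (hv : ‖v‖ = 1) (huv : inner ℝ u v = 0) :
    (ProbabilityTheory.stdGaussian E).map (fun x => (⟨inner ℝ u x, inner ℝ v x⟩ : ℂ)) =
      ProbabilityTheory.stdGaussian ℂ := by
  have hc : Continuous (fun x : E => (⟨inner ℝ u x, inner ℝ v x⟩ : ℂ)) := by
    have : (fun x : E => (⟨inner ℝ u x, inner ℝ v x⟩ : ℂ)) =
        fun x => (inner ℝ u x : ℂ) + (inner ℝ v x : ℂ) * Complex.I := by
      ext x; exact Complex.mk_eq_add_mul_I _ _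
    rw [this]
    fun_prop
  have := Measure.isProbabilityMeasure_map (μ := ProbabilityTheory.stdGaussian E) hc.aemeasurable
  refine Measure.ext_of_charFun ?_
  ext z
  have hnorm : ‖z.re • u + z.im • v‖ ^ 2 = ‖z‖ ^ 2 := by
    rw [norm_add_sq_real, norm_smul, norm_smul, hu, hv, inner_smul_left, inner_smul_right, huv,
      ← Complex.normSq_eq_norm_sq, Complex.normSq_apply]
    simp [← sq]
  have key : charFun ((ProbabilityTheory.stdGaussian E).map
      (fun x => (⟨inner ℝ u x, inner ℝ v x⟩ : ℂ))) z =
      charFun (ProbabilityTheory.stdGaussian E) (z.re • u + z.im • v) := by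
    rw [charFun_apply, integral_map hc.aemeasurable (by fun_prop), charFun_apply]
    congr with x
    rw [inner_add_right, inner_smul_right, inner_smul_right, real_inner_comm, Complex.inner,
      real_inner_comm u x, real_inner_comm v x]
    simp [mul_comm]
  rw [key, ProbabilityTheory.charFun_stdGaussian, ProbabilityTheory.charFun_stdGaussian]
  exact_mod_cast congrArg (fun r : ℝ => Complex.exp (-(r : ℂ) / 2)) hnorm

theorem lintegral_mul_exp_neg_sq_div_two :
    ∫⁻ r in Set.Ioi (0 : ℝ), ENNReal.ofReal (r * Real.exp (-r ^ 2 / 2)) = 1 := by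
  have hfun (r : ℝ) : r * Real.exp (-(1 / 2) * r ^ 2) = r * Real.exp (-r ^ 2 / 2) := by
    congr 2; ring
  have hint := integrable_mul_exp_neg_mul_sq (b := 1 / 2) (by norm_num)
  have h := integral_mul_cexp_neg_mul_sq (b := 1 / 2) (by norm_num)
  simp_rw [hfun] at hint
  rw [← ofReal_integral_eq_lintegral_ofReal hint.integrableOn
    (ae_restrict_of_forall_mem measurableSet_Ioi fun r (hr : 0 < r) => by positivity)]
  have h' : ∫ r in Set.Ioi (0 : ℝ), r * Real.exp (-r ^ 2 / 2) = 1 := by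
    apply Complex.ofReal_injective
    rw [← integral_complex_ofReal]
    refine Eq.trans (integral_congr_ae (ae_of_all _ fun r => ?_)) (h.trans (by norm_num))
    simp only [← hfun]
    push_cast
    rfl
  rw [h', ENNReal.ofReal_one]

/-- Two half-planes whose boundaries cross at height `c` with angle `2 * β` differ by a set of
Gaussian mass at least `β / π * exp (-c ^ 2 / 2)`. -/
theorem le_stdGaussian_symmDiff_halfPlanes {β c : ℝ} (hβ0 : 0 < β) (hβ : β < π / 2) (hc : 0 ≤ c) :
    ENNReal.ofReal (β / π * Real.exp (-c ^ 2 / 2)) ≤ ProbabilityTheory.stdGaussian ℂ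
      (symmDiff {z : ℂ | 0 ≤ cos β * (z.im - c) + sin β * z.re}
        {z : ℂ | 0 ≤ cos β * (z.im - c) - sin β * z.re}) := by
  set S := symmDiff {z : ℂ | 0 ≤ cos β * (z.im - c) + sin β * z.re}
        {z : ℂ | 0 ≤ cos β * (z.im - c) - sin β * z.re} with hS
  have hSm : MeasurableSet S :=
    (measurableSet_le (by fun_prop) (by fun_prop)).symmDiff
      (measurableSet_le (by fun_prop) (by fun_prop))
  set T : Set ℝ := Set.Ioo (-β) 0 ∪ Set.Ioo (-π) (-π + β) with hT
  have hTvol : volume T = ENNReal.ofReal (2 * β) := by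
    rw [hT, measure_union _ measurableSet_Ioo, Real.volume_Ioo, Real.volume_Ioo,
      ← ENNReal.ofReal_add (by linarith) (by linarith)]
    · congr 1; ring
    · refine Set.disjoint_left.2 fun x hx hx' => ?_
      linarith [hx.1, hx'.2]
  have hsub : Set.Ioi (0 : ℝ) ×ˢ T ⊆ polarCoord.target := by
    rw [polarCoord_target]
    refine Set.prod_mono subset_rfl ?_
    rintro x (hx | hx)
    · exact ⟨by linarith [hx.1, pi_pos], by linarith [hx.2, pi_pos]⟩
    · exact ⟨hx.1, by linarith [hx.2, pi_pos]⟩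
  have htrig : ∀ t ∈ T, sin t ≤ 0 ∧
      (0 < sin (β + t) ∧ sin (t - β) < 0 ∨ sin (β + t) < 0 ∧ 0 < sin (t - β)) := by
    rintro t (⟨h1, h2⟩ | ⟨h1, h2⟩)
    · refine ⟨(sin_neg_of_neg_of_neg_pi_lt h2 (by linarith)).le, Or.inl ⟨?_, ?_⟩⟩
      · exact sin_pos_of_pos_of_lt_pi (by linarith) (by linarith)
      · exact sin_neg_of_neg_of_neg_pi_lt (by linarith) (by linarith)
    · refine ⟨(sin_neg_of_neg_of_neg_pi_lt (by linarith) h1).le, Or.inr ⟨?_, ?_⟩⟩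
      · exact sin_neg_of_neg_of_neg_pi_lt (by linarith) (by linarith)
      · rw [← sin_add_two_pi]
        exact sin_pos_of_pos_of_lt_pi (by linarith) (by linarith)
  set K : ℝ := (2 * π)⁻¹ * Real.exp (-c ^ 2 / 2) with hK
  have hK0 : 0 < K := by positivity
  have hpt : ∀ p ∈ Set.Ioi (0 : ℝ) ×ˢ T,
      ENNReal.ofReal K * ENNReal.ofReal (p.1 * Real.exp (-p.1 ^ 2 / 2)) ≤
      ENNReal.ofReal p.1 • S.indicator (fun z => ENNReal.ofReal
        ((2 * π)⁻¹ * Real.exp (-‖z‖ ^ 2 / 2)))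
        (Complex.polarCoord.symm p + (c : ℂ) * Complex.I) := by
    rintro ⟨r, t⟩ ⟨hr, ht⟩
    replace hr : 0 < r := hr
    obtain ⟨hs, hs'⟩ := htrig t ht
    set z : ℂ := Complex.polarCoord.symm (r, t) + (c : ℂ) * Complex.I with hz
    have hre : z.re = r * cos t := by
      simp [hz, Complex.cos_ofReal_re, Complex.sin_ofReal_re]
    have him : z.im = r * sin t + c := by
      simp [hz, Complex.cos_ofReal_re, Complex.sin_ofReal_re]
    have hzS : z ∈ S := by
      have e1 : cos β * (z.im - c) + sin β * z.re = r * sin (β + t) := by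
        rw [hre, him, sin_add]; ring
      have e2 : cos β * (z.im - c) - sin β * z.re = r * sin (t - β) := by
        rw [hre, him, sin_sub]; ring
      rw [hS, Set.mem_symmDiff]
      simp only [Set.mem_ofPred_eq, e1, e2, not_le]
      rcases hs' with ⟨h1, h2⟩ | ⟨h1, h2⟩
      · exact Or.inl ⟨by positivity, mul_neg_of_pos_of_neg hr h2⟩
      · exact Or.inr ⟨by positivity, mul_neg_of_pos_of_neg hr h1⟩
    rw [Set.indicator_of_mem hzS, smul_eq_mul, ← ENNReal.ofReal_mul hK0.le,
      ← ENNReal.ofReal_mul hr.le]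
    refine ENNReal.ofReal_le_ofReal ?_
    have hnorm : ‖z‖ ^ 2 ≤ r ^ 2 + c ^ 2 := by
      rw [← Complex.normSq_eq_norm_sq, Complex.normSq_apply, hre, him]
      have h1 : r * c * sin t ≤ 0 := mul_nonpos_of_nonneg_of_nonpos (by positivity) hs
      nlinarith [sin_sq_add_cos_sq t]
    have hexp : Real.exp (-c ^ 2 / 2) * Real.exp (-r ^ 2 / 2) ≤ Real.exp (-‖z‖ ^ 2 / 2) := by
      rw [← Real.exp_add]
      exact Real.exp_le_exp.2 (by linarith)
    calc K * (r * Real.exp (-r ^ 2 / 2))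
        = r * ((2 * π)⁻¹ * (Real.exp (-c ^ 2 / 2) * Real.exp (-r ^ 2 / 2))) := by rw [hK]; ring
      _ ≤ _ := by gcongr
  have hdens : ProbabilityTheory.stdGaussian ℂ S = ∫⁻ z, S.indicator (fun z : ℂ =>
      ENNReal.ofReal ((2 * π)⁻¹ * Real.exp (-‖z‖ ^ 2 / 2))) z := by
    rw [← withDensity_eq_stdGaussian, withDensity_apply _ hSm, ← lintegral_indicator hSm,
      Complex.finrank_real_complex]
    have : (2 * π) ^ (-((2 : ℕ) : ℝ) / 2) = (2 * π)⁻¹ := by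
      rw [← Real.rpow_neg_one]; norm_num
    rw [this]
  rw [hdens, ← lintegral_add_right_eq_self _ ((c : ℂ) * Complex.I),
    ← Complex.lintegral_comp_polarCoord_symm]
  refine le_trans (le_of_eq ?_) ((setLIntegral_mono' (measurableSet_Ioi.prod
    (measurableSet_Ioo.union measurableSet_Ioo)) hpt).trans (lintegral_mono_set hsub))
  rw [lintegral_const_mul _ (by fun_prop), Measure.volume_eq_prod, ← Measure.prod_restrict]
  have := lintegral_prod_mul (μ := volume.restrict (Set.Ioi (0 : ℝ))) (ν := volume.restrict T)
    (f := fun r => ENNReal.ofReal (r * Real.exp (-r ^ 2 / 2))) (g := fun _ => 1)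
    (by fun_prop) (by fun_prop)
  simp only [mul_one] at this
  rw [this, lintegral_mul_exp_neg_sq_div_two, one_mul, lintegral_one, Measure.restrict_apply_univ,
    hTvol, ← ENNReal.ofReal_mul hK0.le, hK]
  congr 1
  field_simp

/-- Two half-spaces `{x | ‖x - θ‖ ≤ ‖x‖}` with `‖θ‖ = ‖θ'‖` differ by a set whose Gaussian mass
is bounded below in terms of `‖θ - θ'‖` and of the distance `‖θ‖ ^ 2 / ‖θ + θ'‖` from the origin
to the intersection of their boundaries. -/
theorem le_stdGaussian_symmDiff_halfSpaces {E : Type*} [NormedAddCommGroup E]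
    [InnerProductSpace ℝ E] [FiniteDimensional ℝ E] [MeasurableSpace E] [BorelSpace E]
    {θ θ' : E} (hnorm : ‖θ'‖ = ‖θ‖) (hsum : θ + θ' ≠ 0) (hne : θ ≠ θ') :
    ENNReal.ofReal (‖θ - θ'‖ / (2 * π * ‖θ‖) * Real.exp (-(‖θ‖ ^ 2 / ‖θ + θ'‖) ^ 2 / 2)) ≤
      ProbabilityTheory.stdGaussian E
        (symmDiff {x | ‖x - θ‖ ≤ ‖x‖} {x | ‖x - θ'‖ ≤ ‖x‖}) := by
  set R := ‖θ‖ with hR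
  set s := ‖θ + θ'‖ with hs
  set t := ‖θ - θ'‖ with ht
  have hs0 : 0 < s := norm_pos_iff.2 hsum
  have ht0 : 0 < t := norm_pos_iff.2 (sub_ne_zero.2 hne)
  have hpar : s ^ 2 + t ^ 2 = 4 * R ^ 2 := by
    have := parallelogram_law_with_norm ℝ θ θ'
    rw [hnorm] at this
    nlinarith
  have hR0 : 0 < R := by
    rcases (norm_nonneg θ).lt_or_eq with h | h
    · exact h
    · rw [← hR] at h
      rw [← h] at hpar
      nlinarith [sq_pos_of_pos hs0, sq_nonneg t]
  set β := arcsin (t / (2 * R)) with hβ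
  have htR : t / (2 * R) < 1 := by
    rw [div_lt_one (by positivity)]
    nlinarith
  have htR0 : 0 < t / (2 * R) := by positivity
  have hsin : sin β = t / (2 * R) := sin_arcsin (by linarith) htR.le
  have hcos : cos β = s / (2 * R) := by
    rw [hβ, cos_arcsin, ← Real.sqrt_sq (show 0 ≤ s / (2 * R) by positivity)]
    congr 1
    field_simp
    linarith
  have hβ0 : 0 < β := arcsin_pos.2 htR0
  have hβ1 : β < π / 2 := arcsin_lt_pi_div_two.2 htR
  have hβle : t / (2 * R) ≤ β := hsin ▸ sin_le hβ0.le
  have hu : ‖t⁻¹ • (θ - θ')‖ = 1 := by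
    rw [norm_smul, norm_inv, Real.norm_of_nonneg ht0.le, ← ht, inv_mul_cancel₀ ht0.ne']
  have hv : ‖s⁻¹ • (θ + θ')‖ = 1 := by
    rw [norm_smul, norm_inv, Real.norm_of_nonneg hs0.le, ← hs, inv_mul_cancel₀ hs0.ne']
  have huv : inner ℝ (t⁻¹ • (θ - θ')) (s⁻¹ • (θ + θ')) = 0 := by
    rw [real_inner_smul_left, real_inner_smul_right, real_inner_comm,
      (real_inner_add_sub_eq_zero_iff θ θ').2 hnorm.symm, mul_zero, mul_zero]
  have hhalf (η x : E) (hη : ‖η‖ = R) : ‖x - η‖ ≤ ‖x‖ ↔ 0 ≤ inner ℝ η x - R ^ 2 / 2 := by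
    rw [← sq_le_sq₀ (norm_nonneg _) (norm_nonneg _), norm_sub_sq_real, hη, real_inner_comm]
    constructor <;> intro h <;> linarith
  have hcoord (x : E) :
      t * inner ℝ (t⁻¹ • (θ - θ')) x = inner ℝ θ x - inner ℝ θ' x ∧
      s * inner ℝ (s⁻¹ • (θ + θ')) x = inner ℝ θ x + inner ℝ θ' x := by
    rw [real_inner_smul_left, real_inner_smul_left, mul_inv_cancel_left₀ ht0.ne',
      mul_inv_cancel_left₀ hs0.ne', inner_sub_left, inner_add_left]
    exact ⟨rfl, rfl⟩
  have hle := le_stdGaussian_symmDiff_halfPlanes hβ0 hβ1 (c := R ^ 2 / s) (by positivity)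
  have hm : Measurable (fun x : E =>
      (⟨inner ℝ (t⁻¹ • (θ - θ')) x, inner ℝ (s⁻¹ • (θ + θ')) x⟩ : ℂ)) :=
    Complex.measurableEquivRealProd.symm.measurable.comp (by fun_prop :
      Measurable fun x : E => (inner ℝ (t⁻¹ • (θ - θ')) x, inner ℝ (s⁻¹ • (θ + θ')) x))
  rw [← stdGaussian_map_orthonormal_pair hu hv huv, Measure.map_apply hm
    ((measurableSet_le (by fun_prop) (by fun_prop)).symmDiff
      (measurableSet_le (by fun_prop) (by fun_prop))), Set.preimage_symmDiff] at hle
  refine le_trans (ENNReal.ofReal_le_ofReal ?_) (hle.trans_eq ?_)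
  · refine mul_le_mul_of_nonneg_right ?_ (Real.exp_pos _).le
    calc t / (2 * π * R) = t / (2 * R) / π := by field_simp
      _ ≤ β / π := by gcongr
  · congr 2 <;> ext x
    · have e : cos β * (inner ℝ (s⁻¹ • (θ + θ')) x - R ^ 2 / s) +
          sin β * inner ℝ (t⁻¹ • (θ - θ')) x = (inner ℝ θ x - R ^ 2 / 2) / R := by
        obtain ⟨h1, h2⟩ := hcoord x
        rw [hsin, hcos]
        generalize inner ℝ (t⁻¹ • (θ - θ')) x = p at h1 ⊢
        generalize inner ℝ (s⁻¹ • (θ + θ')) x = q at h2 ⊢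
        field_simp
        linarith
      simp only [Set.mem_preimage, Set.mem_ofPred_eq, e, hhalf θ x rfl,
        le_div_iff₀ hR0, zero_mul]
    · have e : cos β * (inner ℝ (s⁻¹ • (θ + θ')) x - R ^ 2 / s) -
          sin β * inner ℝ (t⁻¹ • (θ - θ')) x = (inner ℝ θ' x - R ^ 2 / 2) / R := by
        obtain ⟨h1, h2⟩ := hcoord x
        rw [hsin, hcos]
        generalize inner ℝ (t⁻¹ • (θ - θ')) x = p at h1 ⊢
        generalize inner ℝ (s⁻¹ • (θ + θ')) x = q at h2 ⊢
        field_simp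
        linarith
      simp only [Set.mem_preimage, Set.mem_ofPred_eq, e, hhalf θ' x hnorm,
        le_div_iff₀ hR0, zero_mul]

/-- The point with first coordinate `Δ` and the others `± ε` according to the bits of `x`. -/
noncomputable def signVector {m : ℕ} (Δ ε : ℝ) (x : Fin m → Bool) :
    EuclideanSpace ℝ (Fin (m + 1)) :=
  WithLp.toLp 2 (Fin.cons Δ fun i => if x i then ε else -ε)

theorem norm_signVector_sq {m : ℕ} (Δ ε : ℝ) (x : Fin m → Bool) :
    ‖signVector Δ ε x‖ ^ 2 = Δ ^ 2 + m * ε ^ 2 := by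
  rw [EuclideanSpace.norm_sq_eq, Fin.sum_univ_succ]
  have (i : Fin m) : (if x i then ε else -ε) ^ 2 = ε ^ 2 := by split <;> ring
  simp [signVector, this]

theorem norm_signVector_sub_sq {m : ℕ} (Δ ε : ℝ) (x y : Fin m → Bool) :
    ‖signVector Δ ε x - signVector Δ ε y‖ ^ 2 = 4 * ε ^ 2 * hammingDist x y := by
  rw [EuclideanSpace.norm_sq_eq, Fin.sum_univ_succ]
  have (i : Fin m) : ((if x i then ε else -ε) - (if y i then ε else -ε)) ^ 2 =
      if x i ≠ y i then 4 * ε ^ 2 else 0 := by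
    cases x i <;> cases y i <;> simp <;> ring
  simp only [signVector, PiLp.sub_apply, Fin.cons_zero, Fin.cons_succ, sub_self, norm_zero,
    Real.norm_eq_abs, sq_abs, this, Finset.sum_ite, Finset.sum_const, nsmul_eq_mul, hammingDist]
  ring

/-- Lemma B.1 (finite-dimensional content): there is a packing set
`Θ ⊆ {Δ} × {−ε, ε}^{d−1}` of cardinality at least `e^{(d−1)/8} ≥ 2` such that the
symmetric differences of the associated half-spaces have standard Gaussian mass
at least `(√(d−1)·ε/(4πΔ))·e^{−Δ²}`. -/
theorem packing_halfspaces_gaussian (d : ℕ) (hd : 7 ≤ d) (ε Δ : ℝ) (hε : 0 < ε)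
    (hΔ : Real.sqrt d * ε ≤ Δ)
    (G : Measure (EuclideanSpace ℝ (Fin d)))
    (hG : G = volume.withDensity fun x =>
      ENNReal.ofReal ((2 * π) ^ (-(d : ℝ) / 2) * Real.exp (-‖x‖ ^ 2 / 2))) :
    ∃ Θ : Finset (EuclideanSpace ℝ (Fin d)),
      (∀ θ ∈ Θ, θ ⟨0, by omega⟩ = Δ ∧ ∀ j : Fin d, (j : ℕ) ≠ 0 → θ j = ε ∨ θ j = -ε) ∧
      Real.exp (((d : ℝ) - 1) / 8) ≤ (Θ.card : ℝ) ∧ 2 ≤ Θ.card ∧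
      ∀ θ ∈ Θ, ∀ θ' ∈ Θ, θ ≠ θ' →
        ENNReal.ofReal (Real.sqrt ((d : ℝ) - 1) * ε / (4 * π * Δ) * Real.exp (-Δ ^ 2))
          ≤ G (symmDiff {x | ‖x - θ‖ ≤ ‖x‖} {x | ‖x - θ'‖ ≤ ‖x‖}) := by
  obtain ⟨m, rfl⟩ : ∃ m, d = m + 1 := ⟨d - 1, by omega⟩
  have hm : (6 : ℝ) ≤ m := by exact_mod_cast (by omega : 6 ≤ m)
  have hΔ0 : 0 < Δ := lt_of_lt_of_le (by positivity) hΔ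
  have hεΔ : m * ε ^ 2 ≤ Δ ^ 2 := by
    have h := pow_le_pow_left₀ (by positivity) hΔ 2
    rw [mul_pow, Real.sq_sqrt (by positivity)] at h
    push_cast at h
    nlinarith [sq_nonneg ε]
  have hGstd : G = ProbabilityTheory.stdGaussian (EuclideanSpace ℝ (Fin (m + 1))) := by
    rw [hG, ← withDensity_eq_stdGaussian, finrank_euclideanSpace_fin]
  have hd1 : ((m + 1 : ℕ) : ℝ) - 1 = m := by push_cast; ring
  rw [hd1, hGstd]
  obtain ⟨C, hCcard, hCdist⟩ := exists_code_hammingDist m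
  have hinj : Function.Injective (signVector Δ ε : (Fin m → Bool) → _) := by
    intro x y hxy
    have h := norm_signVector_sub_sq Δ ε x y
    rw [hxy, sub_self, norm_zero] at h
    refine hammingDist_eq_zero.1 ?_
    have : ε ^ 2 ≠ 0 := by positivity
    simpa [this] using h.symm
  refine ⟨C.map ⟨signVector Δ ε, hinj⟩, ?_, ?_, ?_, ?_⟩
  · intro θ hθ
    obtain ⟨x, -, rfl⟩ := Finset.mem_map.1 hθ
    refine ⟨rfl, fun j hj => ?_⟩
    obtain ⟨i, rfl⟩ := Fin.exists_succ_eq.2 (fun h : j = 0 => hj (by simp [h]))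
    simp only [signVector, Function.Embedding.coeFn_mk, Fin.cons_succ]
    split
    · exact Or.inl rfl
    · exact Or.inr rfl
  · rwa [Finset.card_map]
  · rw [Finset.card_map]
    have h1 : (1 : ℝ) < C.card := by
      have := Real.add_one_le_exp ((m : ℝ) / 8)
      linarith
    exact_mod_cast h1
  · intro θ hθ θ' hθ' hne
    obtain ⟨x, hx, rfl⟩ := Finset.mem_map.1 hθ
    obtain ⟨y, hy, rfl⟩ := Finset.mem_map.1 hθ'
    simp only [Function.Embedding.coeFn_mk] at hne ⊢
    have hxy : x ≠ y := fun h => hne (h ▸ rfl)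
    have hdist := hCdist x hx y hy hxy
    have hdist' : (hammingDist x y : ℝ) ≤ m := by
      exact_mod_cast hammingDist_le_card_fintype.trans_eq (Fintype.card_fin m)
    have hnx := norm_signVector_sq Δ ε x
    have hny := norm_signVector_sq Δ ε y
    have hsub := norm_signVector_sub_sq Δ ε x y
    have hpar := parallelogram_law_with_norm ℝ (signVector Δ ε x) (signVector Δ ε y)
    have hnorm : ‖signVector Δ ε y‖ = ‖signVector Δ ε x‖ := by
      rw [← sq_eq_sq₀ (norm_nonneg _) (norm_nonneg _), hnx, hny]
    rw [hnorm] at hpar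
    have hsum2 : (2 * Δ) ^ 2 ≤ ‖signVector Δ ε x + signVector Δ ε y‖ ^ 2 := by
      nlinarith [sq_nonneg ε]
    have hsum : 2 * Δ ≤ ‖signVector Δ ε x + signVector Δ ε y‖ :=
      (sq_le_sq₀ (by positivity) (norm_nonneg _)).1 hsum2
    refine le_trans (ENNReal.ofReal_le_ofReal ?_) (le_stdGaussian_symmDiff_halfSpaces hnorm
      (norm_pos_iff.1 (lt_of_lt_of_le (by positivity) hsum)) hne)
    set R := ‖signVector Δ ε x‖
    set s := ‖signVector Δ ε x + signVector Δ ε y‖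
    set t := ‖signVector Δ ε x - signVector Δ ε y‖
    have hR0 : 0 < R := by
      refine (norm_nonneg _).lt_of_ne' fun h => ?_
      have : 0 < R ^ 2 := by rw [hnx]; positivity
      simp [R, h] at this
    have hexp : (R ^ 2 / s) ^ 2 ≤ Δ ^ 2 := by
      have h1 : R ^ 2 / s ≤ Δ := by
        rw [div_le_iff₀ (by linarith)]
        nlinarith
      exact pow_le_pow_left₀ (div_nonneg (sq_nonneg R) (norm_nonneg _)) h1 2
    have hfac : √m * ε / (4 * π * Δ) ≤ t / (2 * π * R) := by
      have h1 : √m * ε * R ≤ t * (2 * Δ) := by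
        rw [← sq_le_sq₀ (by positivity) (mul_nonneg (norm_nonneg _) (by positivity)), mul_pow,
          mul_pow, mul_pow, Real.sq_sqrt (by positivity), hsub, hnx]
        have h2 : ε ^ 2 * Δ ^ 2 * (m / 8) ≤ ε ^ 2 * Δ ^ 2 * hammingDist x y := by gcongr
        have h3 : m * ε ^ 2 * (m * ε ^ 2) ≤ m * ε ^ 2 * Δ ^ 2 := by gcongr
        nlinarith
      rw [div_le_div_iff₀ (by positivity) (by positivity)]
      nlinarith [pi_pos]
    refine mul_le_mul hfac (Real.exp_le_exp.2 ?_) (Real.exp_pos _).le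
      (div_nonneg (norm_nonneg _) (by positivity))
    nlinarith [sq_nonneg Δ]
end
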